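/- arXiv:1412.5976 — 2 statements merged into one kernel-verified Lean document; each statement's English description precedes it below -/
import Mathlib

section
/- (Atomic ⇒ Prime) Let L be a countable first-order language and T a complete L-theory. If A is a countable atomic model of T, then A is prime: for every model M ⊨ T there is an L-elementary embedding of A into M. -/
open FirstOrder FirstOrder.Language

/-- `φ` is a complete formula for the theory `T`. -/
def IsCompleteFormula {L : FirstOrder.Language.{u, v}} (T : L.Theory) {α : Type*}
    (φ : L.Formula α) : Prop :=
  ∀ ψ : L.Formula α, Xor' (T ⊨ᵇ φ.imp ψ) (T ⊨ᵇ φ.imp ψ.not)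

/-- A model `A` of `T` is atomic if every finite tuple of elements of `A` satisfies some
complete formula for `T` in `A`. -/
def IsAtomicModel {L : FirstOrder.Language.{u, v}} (T : L.Theory) (A : Type*)
    [L.Structure A] : Prop :=
  ∀ (n : ℕ) (a : Fin n → A),
    ∃ φ : L.Formula (Fin n), IsCompleteFormula T φ ∧ φ.Realize a

/-- A model `A` of `T` is prime if it elementarily embeds into every model of `T`. -/
def IsPrimeModel {L : FirstOrder.Language.{u, v}} (T : L.Theory) (A : Type*)
    [L.Structure A] : Prop :=
  ∀ (M : Type (max u v)) [L.Structure M] [Nonempty M], M ⊨ T → Nonempty (A ↪ₑ[L] M)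

universe uL vL wA wM

/-- Over a complete theory, any two models satisfy the same formulas without free variables. -/
theorem FirstOrder.Language.Theory.IsComplete.realize_iff_of_isEmpty
    {L : FirstOrder.Language.{uL, vL}} {T : L.Theory} (hT : T.IsComplete)
    {A : Type wA} [L.Structure A] [Nonempty A] (hA : A ⊨ T)
    {M : Type wM} [L.Structure M] [Nonempty M] (hM : M ⊨ T)
    {α : Type*} [IsEmpty α] (ψ : L.Formula α) (a : α → A) (b : α → M) :
    ψ.Realize a ↔ ψ.Realize b := by
  have key : (ψ.relabel (isEmptyElim : α → Empty)).Realize (default : Empty → A) ↔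
      (ψ.relabel (isEmptyElim : α → Empty)).Realize (default : Empty → M) :=
    (hT.realize_sentence_iff (ψ.relabel isEmptyElim) A).trans
      (hT.realize_sentence_iff (ψ.relabel isEmptyElim) M).symm
  simpa only [Formula.realize_relabel, Subsingleton.elim _ a, Subsingleton.elim _ b] using key

/-- Two tuples satisfying the same complete formula satisfy the same formulas. -/
theorem IsCompleteFormula.realize_iff {L : FirstOrder.Language.{uL, vL}} {T : L.Theory}
    {α : Type*} {φ : L.Formula α} (hφ : IsCompleteFormula T φ)
    {A : Type wA} [L.Structure A] [Nonempty A] (hA : A ⊨ T)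
    {M : Type wM} [L.Structure M] [Nonempty M] (hM : M ⊨ T)
    {a : α → A} {b : α → M} (ha : φ.Realize a) (hb : φ.Realize b) (ψ : L.Formula α) :
    ψ.Realize a ↔ ψ.Realize b := by
  rcases hφ ψ with ⟨h, -⟩ | ⟨h, -⟩
  · exact iff_of_true (Formula.realize_imp.1 (h.realize_formula A) ha)
      (Formula.realize_imp.1 (h.realize_formula M) hb)
  · exact iff_of_false (Formula.realize_not.1 (Formula.realize_imp.1 (h.realize_formula A) ha))
      (Formula.realize_not.1 (Formula.realize_imp.1 (h.realize_formula M) hb))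

/-- A tuple in a model with the same type as an initial segment of a tuple in an atomic model
extends by one coordinate, keeping the same type. -/
theorem IsAtomicModel.exists_snoc {L : FirstOrder.Language.{uL, vL}} {T : L.Theory}
    {A : Type wA} [L.Structure A] [Nonempty A] (hA : A ⊨ T) (hAatomic : IsAtomicModel T A)
    {M : Type wM} [L.Structure M] [Nonempty M] (hM : M ⊨ T)
    {n : ℕ} (a : Fin (n + 1) → A) (b : Fin n → M)
    (hab : ∀ ψ : L.Formula (Fin n), ψ.Realize (a ∘ Fin.castSucc) ↔ ψ.Realize b) :
    ∃ m : M, ∀ ψ : L.Formula (Fin (n + 1)),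
      ψ.Realize a ↔ ψ.Realize (Fin.snoc b m : Fin (n + 1) → M) := by
  obtain ⟨φ, hφ, ha⟩ := hAatomic (n + 1) a
  let g : Fin (n + 1) → Fin n ⊕ Unit := Fin.snoc (α := fun _ ↦ Fin n ⊕ Unit) Sum.inl (Sum.inr ())
  have hg (c : Fin n → M) (d : Unit → M) :
      Sum.elim c d ∘ g = (Fin.snoc c (d ()) : Fin (n + 1) → M) := by
    funext i
    refine Fin.lastCases ?_ (fun j ↦ ?_) i <;> simp [g]
  have hex : ((φ.relabel g).iExs Unit).Realize (a ∘ Fin.castSucc) := by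
    refine (Formula.realize_iExs).2 ⟨fun _ ↦ a (Fin.last n), ?_⟩
    rw [Formula.realize_relabel]
    convert ha
    funext i
    refine Fin.lastCases ?_ (fun j ↦ ?_) i <;> simp [g]
  obtain ⟨m, hm⟩ := Formula.realize_iExs.1 ((hab _).1 hex)
  rw [Formula.realize_relabel, hg] at hm
  exact ⟨m (), hφ.realize_iff hA hM ha hm⟩

/-- A sequence in an atomic model of a complete theory is matched, in any other model, by a
sequence whose finite initial segments have the same types. -/
theorem IsAtomicModel.exists_seq {L : FirstOrder.Language.{uL, vL}} {T : L.Theory}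
    (hT : T.IsComplete) {A : Type wA} [L.Structure A] [Nonempty A] (hA : A ⊨ T)
    (hAatomic : IsAtomicModel T A) {M : Type wM} [L.Structure M] [Nonempty M] (hM : M ⊨ T)
    (e : ℕ → A) :
    ∃ f : ℕ → M, ∀ (n : ℕ) (ψ : L.Formula (Fin n)),
      ψ.Realize (fun i ↦ e i) ↔ ψ.Realize (fun i ↦ f i) := by
  let X (n : ℕ) := {b : Fin n → M //
    ∀ ψ : L.Formula (Fin n), ψ.Realize (fun i ↦ e i) ↔ ψ.Realize b}
  have step (n : ℕ) (b : X n) : ∃ m : M, ∀ ψ : L.Formula (Fin (n + 1)),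
      ψ.Realize (fun i ↦ e i) ↔ ψ.Realize (Fin.snoc b.1 m : Fin (n + 1) → M) :=
    hAatomic.exists_snoc hA hM (fun i ↦ e i) b.1 b.2
  choose next hnext using step
  let s : ∀ n, X n := Nat.rec
    ⟨Fin.elim0, fun ψ ↦ hT.realize_iff_of_isEmpty hA hM ψ _ _⟩
    fun n b ↦ ⟨Fin.snoc b.1 (next n b), hnext n b⟩
  have hs (n : ℕ) : (s n).1 = fun i : Fin n ↦ next i (s i) := by
    induction n with
    | zero => exact Subsingleton.elim _ _
    | succ n ih =>
      change (Fin.snoc (s n).1 (next n (s n)) : Fin (n + 1) → M) = _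
      funext i
      refine Fin.lastCases ?_ (fun j ↦ ?_) i
      · simp
      · simp [congrFun ih j]
  exact ⟨fun n ↦ next n (s n), fun n ψ ↦ by rw [← hs n]; exact (s n).2 ψ⟩

/-- (Atomic ⇒ Prime) A countable atomic model of a complete theory in a countable language
is prime. -/
theorem atomic_implies_prime {L : FirstOrder.Language.{u, v}} [Countable L.Symbols]
    {T : L.Theory} (hT : T.IsComplete)
    (A : Type w) [L.Structure A] [Nonempty A] [Countable A]
    (hA : A ⊨ T) (hAatomic : IsAtomicModel T A) :
    IsPrimeModel T A := by
  intro M _ _ hM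
  obtain ⟨e, he⟩ := exists_surjective_nat A
  obtain ⟨f, hf⟩ := hAatomic.exists_seq hT hA hM e
  refine ⟨⟨f ∘ Function.surjInv he, fun n φ x ↦ ?_⟩⟩
  obtain ⟨N, hN⟩ := (Set.finite_range fun i ↦ Function.surjInv he (x i)).bddAbove
  let g (i : Fin n) : Fin (N + 1) :=
    ⟨Function.surjInv he (x i), Nat.lt_succ_of_le (hN ⟨i, rfl⟩)⟩
  have key := hf (N + 1) (φ.relabel g)
  rw [Formula.realize_relabel, Formula.realize_relabel] at key
  have hx : (fun i : Fin (N + 1) ↦ e i) ∘ g = x := funext fun i ↦ Function.surjInv_eq he (x i)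
  rw [hx] at key
  exact key.symm
end

section
/- (Prime Uniqueness) Let L be a countable first-order language and T a complete L-theory. If A and B are prime models of T, then A and B are isomorphic as L-structures. -/
open FirstOrder FirstOrder.Language

namespace FirstOrder.Language

/-- The truth value of a formula depends only on the values of its free variables. -/
theorem Formula.realize_congr_freeVarFinset {L : Language.{u, v}} {M : Type w} [L.Structure M]
    {α : Type x} [DecidableEq α] (φ : L.Formula α) {s t : α → M}
    (h : ∀ a ∈ BoundedFormula.freeVarFinset φ, s a = t a) : φ.Realize s ↔ φ.Realize t := by
  have hs : (BoundedFormula.restrictFreeVar φ id).Realize (fun a => s a) default ↔ φ.Realize s :=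
    BoundedFormula.realize_restrictFreeVar s (by simp)
  have ht : (BoundedFormula.restrictFreeVar φ id).Realize (fun a => s a) default ↔ φ.Realize t :=
    BoundedFormula.realize_restrictFreeVar t (by simpa using h)
  exact hs.symm.trans ht

/-- Projections of a formula in infinitely many variables to finitely many of them are definable
without parameters. -/
theorem Formula.exists_realize_iff_exists_comp {L : Language.{u, v}} {M : Type w} [L.Structure M]
    [Nonempty M] {α : Type x} [DecidableEq α] (χ : L.Formula α) {n : ℕ} (j : Fin n → α) :
    ∃ θ : L.Formula (Fin n), ∀ b : Fin n → M,
      θ.Realize b ↔ ∃ s : α → M, χ.Realize s ∧ s ∘ j = b := by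
  classical
  let F : Set α := BoundedFormula.freeVarFinset χ ∪ Set.range j
  have hF : (BoundedFormula.freeVarFinset χ : Set α) ⊆ F := Set.subset_union_left
  have : Finite F := ((Finset.finite_toSet _).union (Set.finite_range j)).to_subtype
  let χ' : L.Formula F := BoundedFormula.restrictFreeVar χ (Set.inclusion hF)
  have hχ' (s : α → M) : χ'.Realize (s ∘ (↑)) ↔ χ.Realize s :=
    BoundedFormula.realize_restrictFreeVar' hF
  let j' : Fin n → F := fun i => ⟨j i, Or.inr ⟨i, rfl⟩⟩
  obtain ⟨θ, hθ⟩ := Set.empty_definable_iff.1 <|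
    (Set.empty_definable_iff (M := M).2 ⟨χ', rfl⟩).image_comp j'
  refine ⟨θ, fun b => ?_⟩
  have hb : θ.Realize b ↔ b ∈ Set.image (fun g : F → M => g ∘ j') (Set.ofPred χ'.Realize) := by
    rw [hθ]; rfl
  rw [hb]
  constructor
  · rintro ⟨g, hg, rfl⟩
    let s : α → M := fun a => if h : a ∈ F then g ⟨a, h⟩ else Classical.arbitrary M
    have hs : s ∘ ((↑) : F → α) = g := by
      funext a
      simp only [Function.comp_apply, s, dif_pos a.2]
    refine ⟨s, (hχ' s).1 (hs ▸ hg), ?_⟩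
    change s ∘ ((↑) ∘ j') = g ∘ j'
    rw [← Function.comp_assoc, hs]
  · rintro ⟨s, hs, rfl⟩
    exact ⟨s ∘ (↑), (hχ' s).2 hs, rfl⟩

/-- A Rasiowa–Sikorski principle: there is a sequence in a structure elementarily equivalent to `A`
meeting each of countably many families of formulas, provided each family is dense among the
formulas realized in `A`. -/
theorem exists_generic_sequence {L : Language.{u, v}} {A : Type w} [L.Structure A] [Nonempty A]
    {ι : Type*} [Countable ι] (S : ι → Set (L.Formula ℕ))
    (hS : ∀ i (χ : L.Formula ℕ), (∃ s : ℕ → A, χ.Realize s) →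
      ∃ σ ∈ S i, ∃ s : ℕ → A, χ.Realize s ∧ σ.Realize s) :
    ∃ (N : Type (max u v)) (_ : L.Structure N) (_ : Nonempty N) (s : ℕ → N),
      (∀ φ : L.Formula ℕ, (∀ r : ℕ → A, φ.Realize r) → φ.Realize s) ∧
      ∀ i, ∃ σ ∈ S i, σ.Realize s := by
  classical
  let P := {χ : L.Formula ℕ // ∃ s : ℕ → A, χ.Realize s}
  let _ : Preorder P :=
    { le := fun χ χ' => ∀ s : ℕ → A, χ'.1.Realize s → χ.1.Realize s
      le_refl := fun _ _ h => h
      le_trans := fun _ _ _ h h' s hs => h s (h' s hs) }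
  let _ : Encodable ι := Encodable.ofCountable ι
  let D : ι → Order.Cofinal P := fun i =>
    { carrier := {χ | ∃ σ ∈ S i, ∀ s : ℕ → A, χ.1.Realize s → σ.Realize s}
      isCofinal := by
        intro χ
        obtain ⟨σ, hσ, s, hs, hs'⟩ := hS i χ.1 χ.2
        exact ⟨⟨χ.1 ⊓ σ, s, Formula.realize_inf.2 ⟨hs, hs'⟩⟩,
          ⟨σ, hσ, fun r hr => (Formula.realize_inf.1 hr).2⟩,
          fun r hr => (Formula.realize_inf.1 hr).1⟩ }
  let p : P := ⟨⊤, fun _ => Classical.arbitrary A, Formula.realize_top.2 trivial⟩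
  let G := Order.idealOfCofinals p D
  let U : L[[ℕ]].Theory :=
    {τ | ∃ χ ∈ G, ∀ s : ℕ → A, χ.1.Realize s → (Formula.equivSentence.symm τ).Realize s}
  have hfin : ∀ T₀ : Finset L[[ℕ]].Sentence, (T₀ : L[[ℕ]].Theory) ⊆ U →
      ∃ χ ∈ G, ∀ τ ∈ T₀, ∀ s : ℕ → A, χ.1.Realize s →
        (Formula.equivSentence.symm τ).Realize s := by
    intro T₀
    induction T₀ using Finset.induction_on with
    | empty => exact fun _ => ⟨p, Order.mem_idealOfCofinals p D, by simp⟩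
    | insert τ T₀ _ ih =>
      intro h
      rw [Finset.coe_insert, Set.insert_subset_iff] at h
      obtain ⟨χ, hχ, hχ'⟩ := ih h.2
      obtain ⟨ξ, hξ, hξ'⟩ := h.1
      obtain ⟨ζ, hζ, hχζ, hξζ⟩ := G.directed χ hχ ξ hξ
      refine ⟨ζ, hζ, fun τ' hτ' s hs => ?_⟩
      rcases Finset.mem_insert.1 hτ' with rfl | hτ'
      · exact hξ' s (hξζ s hs)
      · exact hχ' τ' hτ' s (hχζ s hs)
  have hU : U.IsSatisfiable := by
    rw [Theory.isSatisfiable_iff_isFinitelySatisfiable]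
    intro T₀ hT₀
    obtain ⟨χ, -, hχ⟩ := hfin T₀ hT₀
    obtain ⟨s, hs⟩ := χ.2
    let _ : (constantsOn ℕ).Structure A := constantsOn.structure s
    have : A ⊨ (T₀ : L[[ℕ]].Theory) :=
      ⟨fun τ hτ => (Formula.realize_equivSentence_symm A τ s).1 (hχ τ hτ s hs)⟩
    exact Theory.Model.isSatisfiable A
  obtain ⟨N⟩ := hU
  let _ : L.Structure N := (L.lhomWithConstants ℕ).reduct N
  have : (L.lhomWithConstants ℕ).IsExpansionOn N := LHom.isExpansionOn_reduct _ _
  have hN : ∀ φ : L.Formula ℕ, ∀ χ ∈ G, (∀ s : ℕ → A, χ.1.Realize s → φ.Realize s) →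
      φ.Realize fun a => (L.con a : N) := by
    intro φ χ hχ h
    rw [← Formula.realize_equivSentence N φ]
    exact N.is_model.realize_of_mem _ ⟨χ, hχ, by simpa using h⟩
  refine ⟨N, inferInstance, inferInstance, fun a => (L.con a : N), ?_, fun i => ?_⟩
  · exact fun φ hφ => hN φ p (Order.mem_idealOfCofinals p D) fun s _ => hφ s
  · obtain ⟨χ, ⟨σ, hσ, h⟩, hχ⟩ := Order.cofinal_meets_idealOfCofinals p D i
    exact ⟨σ, hσ, hN σ χ hχ h⟩

/-- A formula `θ` isolates the type of the tuple `a` in `A`. -/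
def IsolatesTypeOf {L : Language.{u, v}} {A : Type w} [L.Structure A] {n : ℕ}
    (θ : L.Formula (Fin n)) (a : Fin n → A) : Prop :=
  θ.Realize a ∧ ∀ ψ : L.Formula (Fin n), ψ.Realize a → ∀ b : Fin n → A, θ.Realize b → ψ.Realize b

/-- A structure is atomic if the type of each of its finite tuples is isolated. -/
def IsAtomicStructure (L : Language.{u, v}) (A : Type w) [L.Structure A] : Prop :=
  ∀ (n : ℕ) (a : Fin n → A), ∃ θ : L.Formula (Fin n), IsolatesTypeOf θ a

/-- The formula stating that the `i`-th variable witnesses `φ`, if anything does. -/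
noncomputable def witnessFormula {L : Language.{u, v}} (φ : L.Formula (ℕ ⊕ Fin 1)) (i : ℕ) :
    L.Formula ℕ :=
  (Formula.iExs (Fin 1) φ).imp (φ.relabel (Sum.elim id fun _ => i))

theorem realize_witnessFormula {L : Language.{u, v}} {M : Type w} [L.Structure M]
    {φ : L.Formula (ℕ ⊕ Fin 1)} {i : ℕ} {s : ℕ → M} :
    (witnessFormula φ i).Realize s ↔
      ((∃ c : Fin 1 → M, φ.Realize (Sum.elim s c)) → φ.Realize (Sum.elim s fun _ => s i)) := by
  rw [witnessFormula, Formula.realize_imp, Formula.realize_iExs, Formula.realize_relabel,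
    Sum.comp_elim]
  rfl

theorem exists_realize_witnessFormula {L : Language.{u, v}} {M : Type w} [L.Structure M]
    (φ : L.Formula (ℕ ⊕ Fin 1)) (χ : L.Formula ℕ) (hχ : ∃ s : ℕ → M, χ.Realize s) :
    ∃ (i : ℕ) (s : ℕ → M), χ.Realize s ∧ (witnessFormula φ i).Realize s := by
  classical
  obtain ⟨s, hs⟩ := hχ
  obtain ⟨i, hi⟩ := Infinite.exists_notMem_finset
    (BoundedFormula.freeVarFinset χ ∪ (BoundedFormula.freeVarFinset φ).toLeft)
  rw [Finset.mem_union, not_or, Finset.mem_toLeft] at hi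
  by_cases h : ∃ c : Fin 1 → M, φ.Realize (Sum.elim s c)
  · obtain ⟨c, hc⟩ := h
    refine ⟨i, Function.update s i (c 0), ?_, realize_witnessFormula.2 fun _ => ?_⟩
    · refine (χ.realize_congr_freeVarFinset fun a ha => ?_).1 hs
      rw [Function.update_of_ne]
      rintro rfl
      exact hi.1 ha
    · refine (φ.realize_congr_freeVarFinset fun a ha => ?_).1 hc
      rcases a with a | a
      · simp only [Sum.elim_inl]
        rw [Function.update_of_ne]
        rintro rfl
        exact hi.2 ha
      · simp [Subsingleton.elim a 0]
  · exact ⟨i, s, hs, realize_witnessFormula.2 fun h' => absurd h' h⟩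

/-- If each witness formula is satisfied for some index, the range of the sequence satisfies the
Tarski–Vaught test. -/
theorem meetsDefinable_range {L : Language.{u, v}} {M : Type w} [L.Structure M] (s : ℕ → M)
    (h : ∀ φ : L.Formula (ℕ ⊕ Fin 1), ∃ i, (witnessFormula φ i).Realize s) :
    L.MeetsDefinable (Set.range s) := by
  rintro D ⟨d, hd⟩ hD
  obtain ⟨φ, hφ⟩ := Set.definable_iff_exists_formula_sum.1 hD
  choose g hg using fun a : Set.range s => a.2
  have key (c : Fin 1 → M) :
      (φ.relabel (Sum.map g id)).Realize (Sum.elim s c) ↔ c 0 ∈ D := by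
    rw [Formula.realize_relabel, Sum.elim_comp_map, Function.comp_id,
      show s ∘ g = (↑) from funext hg]
    exact (Set.ext_iff.1 hφ c).symm
  obtain ⟨i, hi⟩ := h (φ.relabel (Sum.map g id))
  exact ⟨s i, (key _).1 (realize_witnessFormula.1 hi ⟨fun _ => d, (key _).2 hd⟩), i, rfl⟩

/-- The structure in the Rasiowa–Sikorski principle may be taken to be enumerated by the generic
sequence. -/
theorem exists_surjective_generic_sequence {L : Language.{u, v}} [Countable L.Symbols] {A : Type w}
    [L.Structure A] [Nonempty A] {ι : Type*} [Countable ι] (S : ι → Set (L.Formula ℕ))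
    (hS : ∀ i (χ : L.Formula ℕ), (∃ s : ℕ → A, χ.Realize s) →
      ∃ σ ∈ S i, ∃ s : ℕ → A, χ.Realize s ∧ σ.Realize s) :
    ∃ (N : Type (max u v)) (_ : L.Structure N) (_ : Nonempty N) (s : ℕ → N),
      Function.Surjective s ∧ (∀ φ : L.Sentence, A ⊨ φ → N ⊨ φ) ∧
      ∀ i, ∃ σ ∈ S i, σ.Realize s := by
  let S' : L.Formula (ℕ ⊕ Fin 1) ⊕ ι → Set (L.Formula ℕ) :=
    Sum.elim (fun φ => Set.range (witnessFormula φ)) S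
  obtain ⟨N, _, _, s, hs, hsS⟩ := exists_generic_sequence (A := A) S' <| by
    rintro (φ | i) χ hχ
    · obtain ⟨i, s, h⟩ := exists_realize_witnessFormula φ χ hχ
      exact ⟨_, ⟨i, rfl⟩, s, h⟩
    · exact hS i χ hχ
  have hmeets : L.MeetsDefinable (Set.range s) := meetsDefinable_range s fun φ => by
    obtain ⟨_, ⟨i, rfl⟩, hi⟩ := hsS (Sum.inl φ)
    exact ⟨i, hi⟩
  let E := hmeets.toElementarySubstructure
  have hE (x : N) : x ∈ E ↔ x ∈ Set.range s := Set.ext_iff.1 hmeets.closure_eq_self x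
  let t : ℕ → E := fun i => ⟨s i, (hE _).2 ⟨i, rfl⟩⟩
  refine ⟨E, inferInstance, inferInstance, t, fun x => ?_, fun φ hφ => ?_, fun i => ?_⟩
  · obtain ⟨i, hi⟩ := (hE x).1 x.2
    exact ⟨i, Subtype.ext hi⟩
  · rw [E.realize_sentence]
    have h := hs (Formula.relabel Empty.elim φ) fun r => by
      rw [Formula.realize_relabel, Subsingleton.elim (r ∘ Empty.elim) default]
      exact hφ
    rw [Formula.realize_relabel, Subsingleton.elim (s ∘ Empty.elim) default] at h
    exact h
  · obtain ⟨σ, hσ, h⟩ := hsS (Sum.inr i)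
    exact ⟨σ, hσ, (E.subtype.map_formula σ t).1 h⟩

/-- The omitting types theorem for the type of a tuple: a non-isolated type is omitted in some
elementarily equivalent structure. -/
theorem exists_omitting {L : Language.{u, v}} [Countable L.Symbols] {A : Type w}
    [L.Structure A] [Nonempty A] {n : ℕ} (a : Fin n → A)
    (ha : ¬ ∃ θ : L.Formula (Fin n), IsolatesTypeOf θ a) :
    ∃ (N : Type (max u v)) (_ : L.Structure N) (_ : Nonempty N),
      (∀ φ : L.Sentence, A ⊨ φ → N ⊨ φ) ∧
      ∀ b : Fin n → N, ∃ ψ : L.Formula (Fin n), ψ.Realize a ∧ ¬ ψ.Realize b := by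
  obtain ⟨N, _, _, s, hs, hAN, hsS⟩ := exists_surjective_generic_sequence (A := A)
    (fun j : Fin n → ℕ => {σ | ∃ ψ : L.Formula (Fin n), ψ.Realize a ∧ σ = (ψ.relabel j).not}) <| by
    intro j χ hχ
    by_contra! hcon
    have himp : ∀ ψ : L.Formula (Fin n), ψ.Realize a → ∀ s : ℕ → A, χ.Realize s →
        ψ.Realize (s ∘ j) := by
      intro ψ hψ s hs
      have := hcon _ ⟨ψ, hψ, rfl⟩ s hs
      rwa [Formula.realize_not, not_not, Formula.realize_relabel] at this
    obtain ⟨θ, hθ⟩ := χ.exists_realize_iff_exists_comp (M := A) j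
    refine ha ⟨θ, ?_, ?_⟩
    · by_contra hna
      obtain ⟨s, hs⟩ := hχ
      exact Formula.realize_not.1 (himp θ.not (Formula.realize_not.2 hna) s hs)
        ((hθ _).2 ⟨s, hs, rfl⟩)
    · intro ψ hψ b hb
      obtain ⟨s, hs, rfl⟩ := (hθ b).1 hb
      exact himp ψ hψ s hs
  refine ⟨N, inferInstance, inferInstance, hAN, fun b => ?_⟩
  choose j hj using fun i => hs (b i)
  obtain ⟨_, ⟨ψ, hψ, rfl⟩, h⟩ := hsS j
  rw [Formula.realize_not, Formula.realize_relabel, show s ∘ j = b from funext hj] at h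
  exact ⟨ψ, hψ, h⟩

/-- A set of pairs is a partial elementary map if it preserves and reflects all formulas. -/
def IsPartialElementary (L : Language.{u, v}) {A : Type w} {B : Type x} [L.Structure A]
    [L.Structure B] (R : Set (A × B)) : Prop :=
  ∀ (n : ℕ) (z : Fin n → A × B), (∀ i, z i ∈ R) → ∀ φ : L.Formula (Fin n),
    φ.Realize (Prod.fst ∘ z) ↔ φ.Realize (Prod.snd ∘ z)

namespace IsPartialElementary

variable {L : Language.{u, v}} {A : Type w} {B : Type x} [L.Structure A] [L.Structure B]

theorem empty (h : A ≅[L] B) : IsPartialElementary L (∅ : Set (A × B)) := by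
  intro n z hz φ
  obtain rfl : n = 0 := by
    rcases n with _ | n
    · rfl
    · exact (hz 0).elim
  have h' := elementarilyEquivalent_iff.1 h (φ.relabel Fin.elim0)
  simp only [Sentence.Realize, Formula.realize_relabel] at h'
  convert h' using 2

theorem swap {R : Set (A × B)} (h : IsPartialElementary L R) :
    IsPartialElementary L (Set.preimage Prod.swap R) :=
  fun n z hz φ => (h n (Prod.swap ∘ z) hz φ).symm

/-- Tuples enumerating a partial elementary map control it entirely. -/
theorem of_range {R : Set (A × B)} {n : ℕ} (z : Fin n → A × B) (hz : R ⊆ Set.range z)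
    (h : ∀ φ : L.Formula (Fin n), φ.Realize (Prod.fst ∘ z) → φ.Realize (Prod.snd ∘ z)) :
    IsPartialElementary L R := by
  intro m y hy φ
  choose j hj using fun i => hz (hy i)
  obtain rfl : z ∘ j = y := funext hj
  have h₁ := h (φ.relabel j)
  have h₂ := h (φ.relabel j).not
  simp only [Formula.realize_not, Formula.realize_relabel] at h₁ h₂
  exact ⟨h₁, not_imp_not.1 h₂⟩

theorem exists_insert (hA : IsAtomicStructure L A) {R : Set (A × B)} (hR : R.Finite)
    (h : IsPartialElementary L R) (a : A) : ∃ b : B, IsPartialElementary L (insert (a, b) R) := by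
  obtain ⟨n, z, -, rfl⟩ := hR.fin_param
  have hz (i : Fin n) : z i ∈ Set.range z := ⟨i, rfl⟩
  let e : Fin (n + 1) → Fin n ⊕ Fin 1 := finSumFinEquiv.symm
  have he : Function.Surjective e := finSumFinEquiv.symm.surjective
  obtain ⟨θ, hθa, hθ⟩ := hA (n + 1) (Sum.elim (Prod.fst ∘ z) (fun _ => a) ∘ e)
  have hex := (h n z hz (Formula.iExs (Fin 1) (θ.relabel e))).1 <|
    Formula.realize_iExs.2 ⟨fun _ => a, Formula.realize_relabel.2 hθa⟩
  obtain ⟨c, hc⟩ := Formula.realize_iExs.1 hex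
  rw [Formula.realize_relabel] at hc
  have hc0 : (fun _ => c 0) = c := funext fun i => congrArg c (Subsingleton.elim _ _)
  refine ⟨c 0, of_range (Sum.elim z (fun _ => (a, c 0)) ∘ e) ?_ fun ψ hψ => ?_⟩
  · rintro p (rfl | ⟨i, rfl⟩)
    · obtain ⟨k, hk⟩ := he (Sum.inr 0)
      exact ⟨k, by simp [hk]⟩
    · obtain ⟨k, hk⟩ := he (Sum.inl i)
      exact ⟨k, by simp [hk]⟩
  · rw [← Function.comp_assoc, Sum.comp_elim] at hψ ⊢
    have hall := (h n z hz (Formula.iAlls (Fin 1) ((θ.imp ψ).relabel e))).1 <|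
      Formula.realize_iAlls.2 fun d => Formula.realize_relabel.2 <|
        Formula.realize_imp.2 fun hd => hθ ψ hψ _ hd
    have himp := Formula.realize_imp.1 (Formula.realize_relabel.1 (Formula.realize_iAlls.1 hall c))
    change ψ.Realize (Sum.elim (Prod.snd ∘ z) (fun _ => c 0) ∘ e)
    rw [hc0]
    exact himp hc

end IsPartialElementary

/-- Countable atomic elementarily equivalent structures are isomorphic. -/
theorem IsAtomicStructure.nonempty_equiv {L : Language.{u, v}} {A : Type w} {B : Type x}
    [L.Structure A] [L.Structure B] [Countable A] [Countable B]
    (hA : IsAtomicStructure L A) (hB : IsAtomicStructure L B) (h : A ≅[L] B) :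
    Nonempty (A ≃[L] B) := by
  let P := {R : Set (A × B) // R.Finite ∧ IsPartialElementary L R}
  let _ : Encodable (A ⊕ B) := Encodable.ofCountable _
  let D : A ⊕ B → Order.Cofinal P := Sum.elim
    (fun a =>
      { carrier := {R | ∃ b, (a, b) ∈ R.1}
        isCofinal := fun R => by
          obtain ⟨b, hb⟩ := R.2.2.exists_insert hA R.2.1 a
          exact ⟨⟨_, R.2.1.insert _, hb⟩, ⟨b, Set.mem_insert _ _⟩, Set.subset_insert _ _⟩ })
    (fun b =>
      { carrier := {R | ∃ a, (a, b) ∈ R.1}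
        isCofinal := fun R => by
          obtain ⟨a, ha⟩ := R.2.2.swap.exists_insert hB
            (R.2.1.preimage Prod.swap_injective.injOn) b
          have ha' : IsPartialElementary L (insert (a, b) R.1) := by
            convert ha.swap using 1
            ext ⟨a', b'⟩
            simp [and_comm]
          exact ⟨⟨_, R.2.1.insert _, ha'⟩, ⟨a, Set.mem_insert _ _⟩, Set.subset_insert _ _⟩ })
  let p : P := ⟨∅, Set.finite_empty, .empty h⟩
  let G := Order.idealOfCofinals p D
  let R : Set (A × B) := {q | ∃ r ∈ G, q ∈ r.1}
  have hR : IsPartialElementary L R := by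
    intro n z hz φ
    choose r hr hzr using hz
    have : Nonempty {r // r ∈ G} := ⟨⟨p, Order.mem_idealOfCofinals p D⟩⟩
    obtain ⟨r', hle⟩ := (directedOn_iff_directed.1 G.directed).finite_le
      (fun i => (⟨r i, hr i⟩ : {r // r ∈ G}))
    exact r'.1.2.2 n z (fun i => hle i (hzr i)) φ
  have hleft (a : A) : ∃ b, (a, b) ∈ R := by
    obtain ⟨r, ⟨b, hb⟩, hr⟩ := Order.cofinal_meets_idealOfCofinals p D (Sum.inl a)
    exact ⟨b, r, hr, hb⟩
  have hright (b : B) : ∃ a, (a, b) ∈ R := by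
    obtain ⟨r, ⟨a, ha⟩, hr⟩ := Order.cofinal_meets_idealOfCofinals p D (Sum.inr b)
    exact ⟨a, r, hr, ha⟩
  choose f hf using hleft
  let F : A ↪ₑ[L] B := ⟨f, fun n φ x => (hR n (fun i => (x i, f (x i))) (fun i => hf _) φ).symm⟩
  have hsurj : Function.Surjective F := by
    intro b
    obtain ⟨a, ha⟩ := hright b
    refine ⟨a, ?_⟩
    have heq := (hR 2 ![(a, f a), (a, b)] (by simp [Fin.forall_fin_two, hf, ha])
      (Term.equal (Term.var 0) (Term.var 1))).1 (by simp [Formula.realize_equal])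
    rw [Formula.realize_equal] at heq
    exact heq
  exact ⟨{ Equiv.ofBijective F ⟨F.injective, hsurj⟩ with
    map_fun' := fun g x => F.map_fun g x
    map_rel' := fun r x => F.map_rel r x }⟩

end FirstOrder.Language

/-- A prime model in a countable language is countable. -/
theorem IsPrimeModel.countable {L : FirstOrder.Language.{u, v}} [Countable L.Symbols]
    {T : L.Theory} {A : Type w} [L.Structure A] [Nonempty A] (hA : A ⊨ T)
    (hprime : IsPrimeModel T A) : Countable A := by
  obtain ⟨N, _, _, s, hs, hN, -⟩ := exists_surjective_generic_sequence (A := A)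
    (fun i : Empty => (i.elim : Set (L.Formula ℕ))) fun i => i.elim
  obtain ⟨e⟩ := hprime N ⟨fun φ hφ => hN φ (hA.realize_of_mem φ hφ)⟩
  have := hs.countable
  exact e.injective.countable

/-- A prime model in a countable language is atomic. -/
theorem IsPrimeModel.isAtomicStructure {L : FirstOrder.Language.{u, v}} [Countable L.Symbols]
    {T : L.Theory} {A : Type w} [L.Structure A] [Nonempty A] (hA : A ⊨ T)
    (hprime : IsPrimeModel T A) : IsAtomicStructure L A := by
  intro n a
  by_contra ha
  obtain ⟨N, _, _, hN, hom⟩ := exists_omitting a ha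
  obtain ⟨e⟩ := hprime N ⟨fun φ hφ => hN φ (hA.realize_of_mem φ hφ)⟩
  obtain ⟨ψ, hψ, hn⟩ := hom (e ∘ a)
  exact hn ((e.map_formula ψ a).2 hψ)

/-- (Prime Uniqueness) If `A` and `B` are prime models of a complete theory `T` in a
countable language, then `A ≅ B`. -/
theorem prime_uniqueness {L : FirstOrder.Language.{u, v}} [Countable L.Symbols]
    {T : L.Theory} (hT : T.IsComplete)
    (A : Type w) (B : Type x) [L.Structure A] [L.Structure B]
    [Nonempty A] [Nonempty B]
    (hA : A ⊨ T) (hB : B ⊨ T)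
    (hAprime : IsPrimeModel T A) (hBprime : IsPrimeModel T B) :
    Nonempty (A ≃[L] B) := by
  have := hAprime.countable hA
  have := hBprime.countable hB
  exact (hAprime.isAtomicStructure hA).nonempty_equiv (hBprime.isAtomicStructure hB)
    (hT.models_elementarily_equivalent A B)
end
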